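/- Assume the standing assumptions. Then for all Y, Y′ ∈ 𝒴 and every Z ∈ ℝ^{m×n}: ‖X(Y, Z) − X(Y′, Z)‖_F ≤ σ₂ · ‖Y − Y′‖_F, where σ₂ := 2R_X/(r−μ_ρ). -/

import Mathlib

open Matrix

noncomputable section

/-- Frobenius inner product `⟨A,B⟩ = tr(AᵀB)`. -/
def frobInner {m n : ℕ} (A B : Matrix (Fin m) (Fin n) ℝ) : ℝ := (Aᵀ * B).trace

/-- Frobenius norm. -/
def frobNorm {m n : ℕ} (A : Matrix (Fin m) (Fin n) ℝ) : ℝ := Real.sqrt (frobInner A A)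

/-- Spectral (operator) norm of a matrix. -/
def specNorm {m n : ℕ} (A : Matrix (Fin m) (Fin n) ℝ) : ℝ :=
  ‖LinearMap.toContinuousLinearMap (Matrix.toEuclideanLin A)‖

/-- `G(X) := XᵀX − Iₙ`. -/
def Gm {m n : ℕ} (X : Matrix (Fin m) (Fin n) ℝ) : Matrix (Fin n) (Fin n) ℝ := Xᵀ * X - 1

/-- `gradl` is the (Fréchet) gradient of `ℓ` w.r.t. the Frobenius inner product. -/
def IsGradientOf {m n : ℕ} (gradl : Matrix (Fin m) (Fin n) ℝ → Matrix (Fin m) (Fin n) ℝ)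
    (ℓ : Matrix (Fin m) (Fin n) ℝ → ℝ) : Prop :=
  ∀ X : Matrix (Fin m) (Fin n) ℝ, ∀ c : ℝ, 0 < c → ∃ δ : ℝ, 0 < δ ∧
    ∀ H : Matrix (Fin m) (Fin n) ℝ, frobNorm H ≤ δ →
      |ℓ (X + H) - ℓ X - frobInner (gradl X) H| ≤ c * frobNorm H

/-- Augmented Lagrangian `ℒ_ρ(X,Y) = f(X) + ⟨Y, G(X)⟩ + (ρ/2)‖G(X)‖_F²` with `f = ℓ + g`. -/
def Lag {m n : ℕ} (ℓ g : Matrix (Fin m) (Fin n) ℝ → ℝ) (ρ : ℝ)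
    (X : Matrix (Fin m) (Fin n) ℝ) (Y : Matrix (Fin n) (Fin n) ℝ) : ℝ :=
  ℓ X + g X + frobInner Y (Gm X) + ρ / 2 * frobNorm (Gm X) ^ 2

/-- `F(X,Y,Z) = ℒ_ρ(X,Y) − (ε/2)‖Y‖_F² + (r/2)‖X−Z‖_F²`. -/
def Ffun {m n : ℕ} (ℓ g : Matrix (Fin m) (Fin n) ℝ → ℝ) (ρ r ε : ℝ)
    (X : Matrix (Fin m) (Fin n) ℝ) (Y : Matrix (Fin n) (Fin n) ℝ)
    (Z : Matrix (Fin m) (Fin n) ℝ) : ℝ :=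
  Lag ℓ g ρ X Y - ε / 2 * frobNorm Y ^ 2 + r / 2 * frobNorm (X - Z) ^ 2

/-- Dual function `d(Y,Z) = min_{X ∈ 𝒳} F(X,Y,Z)`. -/
def dfun {m n : ℕ} (𝒳 : Set (Matrix (Fin m) (Fin n) ℝ))
    (ℓ g : Matrix (Fin m) (Fin n) ℝ → ℝ) (ρ r ε : ℝ)
    (Y : Matrix (Fin n) (Fin n) ℝ) (Z : Matrix (Fin m) (Fin n) ℝ) : ℝ :=
  sInf ((fun X => Ffun ℓ g ρ r ε X Y Z) '' 𝒳)

/-- Proximal function `p(Z) = max_{Y ∈ 𝒴} d(Y,Z)`. -/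
def pfun {m n : ℕ} (𝒳 : Set (Matrix (Fin m) (Fin n) ℝ))
    (𝒴 : Set (Matrix (Fin n) (Fin n) ℝ))
    (ℓ g : Matrix (Fin m) (Fin n) ℝ → ℝ) (ρ r ε : ℝ)
    (Z : Matrix (Fin m) (Fin n) ℝ) : ℝ :=
  sSup ((fun Y => dfun 𝒳 ℓ g ρ r ε Y Z) '' 𝒴)

/-- Potential function `Φ(X,Y,Z) = F(X,Y,Z) − 2d(Y,Z) + 2p(Z)`. -/
def Phi {m n : ℕ} (𝒳 : Set (Matrix (Fin m) (Fin n) ℝ))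
    (𝒴 : Set (Matrix (Fin n) (Fin n) ℝ))
    (ℓ g : Matrix (Fin m) (Fin n) ℝ → ℝ) (ρ r ε : ℝ)
    (X : Matrix (Fin m) (Fin n) ℝ) (Y : Matrix (Fin n) (Fin n) ℝ)
    (Z : Matrix (Fin m) (Fin n) ℝ) : ℝ :=
  Ffun ℓ g ρ r ε X Y Z - 2 * dfun 𝒳 ℓ g ρ r ε Y Z + 2 * pfun 𝒳 𝒴 ℓ g ρ r ε Z

/-- Linearized augmented Lagrangian `ℒ_{X̄,λ}(X,Y)`. -/
def LinLag {m n : ℕ} (ℓ g : Matrix (Fin m) (Fin n) ℝ → ℝ)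
    (gradl : Matrix (Fin m) (Fin n) ℝ → Matrix (Fin m) (Fin n) ℝ) (ρ lam : ℝ)
    (Xb X : Matrix (Fin m) (Fin n) ℝ) (Y : Matrix (Fin n) (Fin n) ℝ) : ℝ :=
  ℓ Xb + frobInner Y (Gm Xb) + ρ / 2 * frobNorm (Gm Xb) ^ 2 + g X
    + frobInner (gradl Xb) (X - Xb)
    + frobInner ((2 : ℝ) • (Xb * (Y + ρ • Gm Xb))) (X - Xb)
    + 1 / (2 * lam) * frobNorm (X - Xb) ^ 2

lemma frobInner_eq_sum {m n : ℕ} (A B : Matrix (Fin m) (Fin n) ℝ) :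
    frobInner A B = ∑ j, ∑ i, A i j * B i j := by
  simp [frobInner, Matrix.trace, Matrix.mul_apply]

lemma frobInner_comm {m n : ℕ} (A B : Matrix (Fin m) (Fin n) ℝ) :
    frobInner A B = frobInner B A := by
  simp only [frobInner_eq_sum, mul_comm]

lemma frobInner_transpose {m n : ℕ} (A B : Matrix (Fin m) (Fin n) ℝ) :
    frobInner Aᵀ Bᵀ = frobInner A B := by
  simp only [frobInner_eq_sum, Matrix.transpose_apply]
  exact Finset.sum_comm

lemma frobInner_add_left {m n : ℕ} (A B C : Matrix (Fin m) (Fin n) ℝ) :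
    frobInner (A + B) C = frobInner A C + frobInner B C := by
  simp [frobInner, Matrix.add_mul]

lemma frobInner_sub_left {m n : ℕ} (A B C : Matrix (Fin m) (Fin n) ℝ) :
    frobInner (A - B) C = frobInner A C - frobInner B C := by
  simp [frobInner, Matrix.sub_mul]

lemma frobInner_smul_left {m n : ℕ} (c : ℝ) (A B : Matrix (Fin m) (Fin n) ℝ) :
    frobInner (c • A) B = c * frobInner A B := by
  simp [frobInner]

lemma frobInner_add_right {m n : ℕ} (A B C : Matrix (Fin m) (Fin n) ℝ) :
    frobInner A (B + C) = frobInner A B + frobInner A C := by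
  simp [frobInner, Matrix.mul_add]

lemma frobInner_sub_right {m n : ℕ} (A B C : Matrix (Fin m) (Fin n) ℝ) :
    frobInner A (B - C) = frobInner A B - frobInner A C := by
  simp [frobInner, Matrix.mul_sub]

lemma frobInner_smul_right {m n : ℕ} (c : ℝ) (A B : Matrix (Fin m) (Fin n) ℝ) :
    frobInner A (c • B) = c * frobInner A B := by
  simp [frobInner]

lemma frobInner_mul_right {m n k : ℕ} (A : Matrix (Fin m) (Fin n) ℝ)
    (B : Matrix (Fin m) (Fin k) ℝ) (C : Matrix (Fin k) (Fin n) ℝ) :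
    frobInner A (B * C) = frobInner (Bᵀ * A) C := by
  simp [frobInner, Matrix.transpose_mul, Matrix.mul_assoc]

lemma frobInner_self_nonneg {m n : ℕ} (A : Matrix (Fin m) (Fin n) ℝ) : 0 ≤ frobInner A A := by
  rw [frobInner_eq_sum]
  exact Finset.sum_nonneg fun j _ => Finset.sum_nonneg fun i _ => mul_self_nonneg _

lemma frobNorm_nonneg {m n : ℕ} (A : Matrix (Fin m) (Fin n) ℝ) : 0 ≤ frobNorm A :=
  Real.sqrt_nonneg _

lemma frobNorm_sq {m n : ℕ} (A : Matrix (Fin m) (Fin n) ℝ) : frobNorm A ^ 2 = frobInner A A :=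
  Real.sq_sqrt (frobInner_self_nonneg A)

lemma frobNorm_transpose {m n : ℕ} (A : Matrix (Fin m) (Fin n) ℝ) :
    frobNorm Aᵀ = frobNorm A := by
  rw [frobNorm, frobInner_transpose, frobNorm]

lemma frobNorm_smul {m n : ℕ} (c : ℝ) (A : Matrix (Fin m) (Fin n) ℝ) :
    frobNorm (c • A) = |c| * frobNorm A := by
  rw [frobNorm, frobInner_smul_left, frobInner_smul_right, ← mul_assoc,
    Real.sqrt_mul (mul_self_nonneg c), Real.sqrt_mul_self_eq_abs, frobNorm]

/-- Cauchy–Schwarz inequality for the Frobenius inner product. -/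
lemma frobInner_le_frobNorm_mul {m n : ℕ} (A B : Matrix (Fin m) (Fin n) ℝ) :
    frobInner A B ≤ frobNorm A * frobNorm B := by
  simp only [frobNorm, frobInner_eq_sum, ← Finset.sum_product', ← pow_two]
  exact Real.sum_mul_le_sqrt_mul_sqrt _ _ _

lemma specNorm_nonneg {m n : ℕ} (A : Matrix (Fin m) (Fin n) ℝ) : 0 ≤ specNorm A :=
  norm_nonneg _

lemma frobNorm_mul_le {m n k : ℕ} (A : Matrix (Fin m) (Fin n) ℝ)
    (B : Matrix (Fin n) (Fin k) ℝ) : frobNorm (A * B) ≤ specNorm A * frobNorm B := by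
  refine (sq_le_sq₀ (frobNorm_nonneg _) (mul_nonneg (specNorm_nonneg A) (frobNorm_nonneg B))).1 ?_
  rw [mul_pow, frobNorm_sq, frobNorm_sq, frobInner_eq_sum, frobInner_eq_sum, Finset.mul_sum]
  refine Finset.sum_le_sum fun j _ => ?_
  have h := (LinearMap.toContinuousLinearMap (Matrix.toEuclideanLin A)).le_opNorm
    (WithLp.toLp 2 (B.col j))
  have h2 := pow_le_pow_left₀ (norm_nonneg _) h 2
  rw [mul_pow, EuclideanSpace.norm_sq_eq, EuclideanSpace.norm_sq_eq] at h2
  simpa [specNorm, Matrix.mul_apply, Matrix.mulVec, dotProduct, pow_two,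
    Matrix.toLpLin_apply] using h2

lemma specNorm_le_frobNorm {m n : ℕ} (A : Matrix (Fin m) (Fin n) ℝ) :
    specNorm A ≤ frobNorm A := by
  refine ContinuousLinearMap.opNorm_le_bound _ (frobNorm_nonneg A) fun v => ?_
  refine (sq_le_sq₀ (norm_nonneg _) (mul_nonneg (frobNorm_nonneg A) (norm_nonneg v))).1 ?_
  rw [mul_pow, EuclideanSpace.norm_sq_eq, EuclideanSpace.norm_sq_eq, frobNorm_sq,
    frobInner_eq_sum, Finset.sum_comm, Finset.sum_mul]
  refine Finset.sum_le_sum fun i _ => ?_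
  have h := Finset.sum_mul_sq_le_sq_mul_sq Finset.univ (A i) v.ofLp
  simpa [Matrix.toLpLin_apply, Matrix.mulVec, dotProduct, pow_two] using h

lemma hasDerivAt_along_line {m n : ℕ} {ℓ : Matrix (Fin m) (Fin n) ℝ → ℝ}
    {gradl : Matrix (Fin m) (Fin n) ℝ → Matrix (Fin m) (Fin n) ℝ} (h : IsGradientOf gradl ℓ)
    (X D : Matrix (Fin m) (Fin n) ℝ) (t : ℝ) :
    HasDerivAt (fun s : ℝ => ℓ (X + s • D)) (frobInner (gradl (X + t • D)) D) t := by
  rw [hasDerivAt_iff_isLittleO, Asymptotics.isLittleO_iff]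
  intro c hc
  have hD : 0 < frobNorm D + 1 := by linarith [frobNorm_nonneg D]
  obtain ⟨δ, hδ, hb⟩ := h (X + t • D) (c / (frobNorm D + 1)) (by positivity)
  filter_upwards [Metric.ball_mem_nhds t (div_pos hδ hD)] with s hs
  rw [Metric.mem_ball, Real.dist_eq, lt_div_iff₀ hD] at hs
  have hH : frobNorm ((s - t) • D) ≤ |s - t| * (frobNorm D + 1) := by
    rw [frobNorm_smul]
    exact mul_le_mul_of_nonneg_left (by linarith) (abs_nonneg _)
  have key := hb ((s - t) • D) (hH.trans hs.le)
  rw [show X + t • D + (s - t) • D = X + s • D by module, frobInner_smul_right] at key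
  rw [smul_eq_mul, Real.norm_eq_abs, Real.norm_eq_abs]
  refine key.trans ((mul_le_mul_of_nonneg_left hH (by positivity)).trans_eq ?_)
  field_simp

/-- A function with `Lℓ`-Lipschitz gradient on a convex set is `Lℓ`-weakly convex there. -/
lemma weaklyConvex_of_lipschitz_gradient {m n : ℕ} {𝒳 : Set (Matrix (Fin m) (Fin n) ℝ)}
    (h𝒳 : Convex ℝ 𝒳) {ℓ : Matrix (Fin m) (Fin n) ℝ → ℝ}
    {gradl : Matrix (Fin m) (Fin n) ℝ → Matrix (Fin m) (Fin n) ℝ} {Lℓ : ℝ}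
    (hgrad : IsGradientOf gradl ℓ)
    (hLip : ∀ X ∈ 𝒳, ∀ X' ∈ 𝒳, frobNorm (gradl X - gradl X') ≤ Lℓ * frobNorm (X - X'))
    {X D : Matrix (Fin m) (Fin n) ℝ} (hX : X ∈ 𝒳) (hXD : X + D ∈ 𝒳)
    {t : ℝ} (ht0 : 0 ≤ t) (ht1 : t ≤ 1) :
    ℓ (X + t • D) ≤
      (1 - t) * ℓ X + t * ℓ (X + D) + Lℓ / 2 * (t * (1 - t)) * frobNorm D ^ 2 := by
  have hder : ∀ s : ℝ, HasDerivAt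
      (fun s : ℝ => ℓ (X + s • D) + Lℓ / 2 * frobNorm D ^ 2 * s ^ 2)
      (frobInner (gradl (X + s • D)) D + Lℓ * frobNorm D ^ 2 * s) s := fun s => by
    refine (hasDerivAt_along_line hgrad X D s).add ?_
    refine ((hasDerivAt_pow 2 s).const_mul (Lℓ / 2 * frobNorm D ^ 2)).congr_deriv ?_
    push_cast
    ring
  have hseg : ∀ s ∈ Set.Icc (0 : ℝ) 1, X + s • D ∈ 𝒳 := fun s hs =>
    h𝒳.add_smul_mem hX hXD hs
  have hmono : MonotoneOn
      (deriv fun s : ℝ => ℓ (X + s • D) + Lℓ / 2 * frobNorm D ^ 2 * s ^ 2)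
      (interior (Set.Icc (0 : ℝ) 1)) := by
    intro a ha b hb hab
    have ha := interior_subset ha
    have hb := interior_subset hb
    rw [(hder a).deriv, (hder b).deriv]
    have h1 := frobInner_le_frobNorm_mul (gradl (X + a • D) - gradl (X + b • D)) D
    have h2 := hLip _ (hseg a ha) _ (hseg b hb)
    rw [show X + a • D - (X + b • D) = (a - b) • D by module, frobNorm_smul,
      abs_of_nonpos (by linarith)] at h2
    have h3 := mul_le_mul_of_nonneg_right h2 (frobNorm_nonneg D)
    rw [frobInner_sub_left] at h1
    linarith
  have hconv := hmono.convexOn_of_deriv (convex_Icc 0 1)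
    (fun s _ => (hder s).continuousAt.continuousWithinAt)
    (fun s _ => (hder s).differentiableAt.differentiableWithinAt)
  have h := hconv.2 (Set.left_mem_Icc.2 zero_le_one) (Set.right_mem_Icc.2 zero_le_one)
    (sub_nonneg.2 ht1) ht0 (sub_add_cancel 1 t)
  simp only [smul_eq_mul, mul_zero, mul_one, zero_add, zero_smul, one_smul, add_zero] at h
  linarith

lemma frobNorm_sq_add_smul {m n : ℕ} (A D : Matrix (Fin m) (Fin n) ℝ) (t : ℝ) :
    frobNorm (A + t • D) ^ 2 =
      (1 - t) * frobNorm A ^ 2 + t * frobNorm (A + D) ^ 2 - t * (1 - t) * frobNorm D ^ 2 := by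
  simp only [frobNorm_sq, frobInner_add_left, frobInner_add_right, frobInner_smul_left,
    frobInner_smul_right, frobInner_comm D A]
  ring

lemma Gm_add_smul {m n : ℕ} (X D : Matrix (Fin m) (Fin n) ℝ) (t : ℝ) :
    Gm (X + t • D) = Gm X + t • (Gm (X + D) - Gm X) - (t * (1 - t)) • (Dᵀ * D) := by
  simp only [Gm, Matrix.transpose_add, Matrix.transpose_smul, Matrix.add_mul, Matrix.mul_add,
    Matrix.smul_mul, Matrix.mul_smul]
  module

lemma neg_frobInner_transpose_mul_self_le {m n : ℕ} (Y : Matrix (Fin n) (Fin n) ℝ)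
    (D : Matrix (Fin m) (Fin n) ℝ) :
    -frobInner Y (Dᵀ * D) ≤ frobNorm Y * frobNorm D ^ 2 := by
  have h1 := frobInner_le_frobNorm_mul ((-1 : ℝ) • (D * Y)) D
  rw [frobInner_smul_left, frobNorm_smul, abs_neg, abs_one, one_mul, neg_one_mul] at h1
  rw [frobInner_mul_right, Matrix.transpose_transpose]
  have h2 := (frobNorm_mul_le D Y).trans
    (mul_le_mul_of_nonneg_right (specNorm_le_frobNorm D) (frobNorm_nonneg Y))
  have h3 := mul_le_mul_of_nonneg_right h2 (frobNorm_nonneg D)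
  linarith

lemma neg_frobInner_Gm_le {m n : ℕ} (X D : Matrix (Fin m) (Fin n) ℝ) :
    -frobInner (Gm X) (Dᵀ * D) ≤ frobNorm D ^ 2 := by
  have h : frobInner (Xᵀ * X) (Dᵀ * D) = frobInner (D * Xᵀ) (D * Xᵀ) := by
    simp only [frobInner, Matrix.transpose_mul, Matrix.transpose_transpose]
    rw [Matrix.mul_assoc, Matrix.trace_mul_comm]
    simp only [Matrix.mul_assoc]
  have h1 : frobInner 1 (Dᵀ * D) = frobInner D D := by simp [frobInner]
  rw [Gm, frobInner_sub_left, h, h1, frobNorm_sq]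
  linarith [frobInner_self_nonneg (D * Xᵀ)]

lemma frobNorm_Gm_sq_add_smul_le {m n : ℕ} (X D : Matrix (Fin m) (Fin n) ℝ) {t : ℝ}
    (ht0 : 0 ≤ t) (ht1 : t ≤ 1) :
    frobNorm (Gm (X + t • D)) ^ 2 ≤ (1 - t) * frobNorm (Gm X) ^ 2
      + t * frobNorm (Gm (X + D)) ^ 2 + 2 * (t * (1 - t)) * frobNorm D ^ 2 := by
  have hs : 0 ≤ t * (1 - t) := mul_nonneg ht0 (by linarith)
  have hG := neg_frobInner_Gm_le (X + t • D) D
  have hA := frobNorm_sq_add_smul (Gm X) (Gm (X + D) - Gm X) t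
  rw [show Gm X + t • (Gm (X + D) - Gm X) = Gm (X + t • D) + (t * (1 - t)) • (Dᵀ * D) by
    rw [Gm_add_smul]; abel, add_sub_cancel] at hA
  have hE : frobNorm (Gm (X + t • D) + (t * (1 - t)) • (Dᵀ * D)) ^ 2 =
      frobNorm (Gm (X + t • D)) ^ 2 + 2 * (t * (1 - t)) * frobInner (Gm (X + t • D)) (Dᵀ * D)
        + (t * (1 - t)) ^ 2 * frobNorm (Dᵀ * D) ^ 2 := by
    simp only [frobNorm_sq, frobInner_add_left, frobInner_add_right, frobInner_smul_left,
      frobInner_smul_right, frobInner_comm (Dᵀ * D) (Gm (X + t • D))]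
    ring
  have h1 := mul_nonneg hs (sq_nonneg (frobNorm (Gm (X + D) - Gm X)))
  have h2 := mul_nonneg (sq_nonneg (t * (1 - t))) (sq_nonneg (frobNorm (Dᵀ * D)))
  have h3 := mul_le_mul_of_nonneg_left hG hs
  linarith

/-- Strong convexity of the regularised augmented Lagrangian along segments. -/
lemma Ffun_add_smul_le {m n : ℕ} {𝒳 : Set (Matrix (Fin m) (Fin n) ℝ)} (h𝒳 : Convex ℝ 𝒳)
    {ℓ g : Matrix (Fin m) (Fin n) ℝ → ℝ}
    {gradl : Matrix (Fin m) (Fin n) ℝ → Matrix (Fin m) (Fin n) ℝ} {Lℓ Lg ρ RY : ℝ} (r ε : ℝ)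
    (hgrad : IsGradientOf gradl ℓ)
    (hLip : ∀ X ∈ 𝒳, ∀ X' ∈ 𝒳, frobNorm (gradl X - gradl X') ≤ Lℓ * frobNorm (X - X'))
    (hgwc : ConvexOn ℝ 𝒳 (fun X => g X + Lg / 2 * frobNorm X ^ 2)) (hρ : 0 ≤ ρ)
    {Y : Matrix (Fin n) (Fin n) ℝ} (hY : frobNorm Y ≤ RY) (Z : Matrix (Fin m) (Fin n) ℝ)
    {X D : Matrix (Fin m) (Fin n) ℝ} (hX : X ∈ 𝒳) (hXD : X + D ∈ 𝒳)
    {t : ℝ} (ht0 : 0 ≤ t) (ht1 : t ≤ 1) :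
    Ffun ℓ g ρ r ε (X + t • D) Y Z ≤
      (1 - t) * Ffun ℓ g ρ r ε X Y Z + t * Ffun ℓ g ρ r ε (X + D) Y Z
        - (r - ((Lℓ + Lg) + 2 * RY + 2 * ρ)) / 2 * (t * (1 - t)) * frobNorm D ^ 2 := by
  have hs : 0 ≤ t * (1 - t) := mul_nonneg ht0 (by linarith)
  have hl := weaklyConvex_of_lipschitz_gradient h𝒳 hgrad hLip hX hXD ht0 ht1
  have hg := hgwc.2 hX hXD (sub_nonneg.2 ht1) ht0 (sub_add_cancel 1 t)
  rw [show (1 - t) • X + t • (X + D) = X + t • D by module] at hg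
  simp only [smul_eq_mul, frobNorm_sq_add_smul X D t] at hg
  have hY1 := mul_le_mul_of_nonneg_left ((neg_frobInner_transpose_mul_self_le Y D).trans
    (mul_le_mul_of_nonneg_right hY (sq_nonneg (frobNorm D)))) hs
  have hYG : frobInner Y (Gm (X + t • D)) = (1 - t) * frobInner Y (Gm X)
      + t * frobInner Y (Gm (X + D)) - t * (1 - t) * frobInner Y (Dᵀ * D) := by
    rw [Gm_add_smul]
    simp only [frobInner_add_right, frobInner_sub_right, frobInner_smul_right]
    ring
  have hZ := frobNorm_sq_add_smul (X - Z) D t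
  rw [show X - Z + t • D = X + t • D - Z by abel, show X - Z + D = X + D - Z by abel] at hZ
  have hG := mul_le_mul_of_nonneg_left (frobNorm_Gm_sq_add_smul_le X D ht0 ht1)
    (div_nonneg hρ zero_le_two)
  simp only [Ffun, Lag]
  rw [hYG, hZ]
  linarith

/-- Quadratic growth of the regularised augmented Lagrangian at a minimiser. -/
lemma Ffun_quadratic_growth {m n : ℕ} {𝒳 : Set (Matrix (Fin m) (Fin n) ℝ)} (h𝒳 : Convex ℝ 𝒳)
    {ℓ g : Matrix (Fin m) (Fin n) ℝ → ℝ}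
    {gradl : Matrix (Fin m) (Fin n) ℝ → Matrix (Fin m) (Fin n) ℝ} {Lℓ Lg ρ RY r ε : ℝ}
    (hgrad : IsGradientOf gradl ℓ)
    (hLip : ∀ X ∈ 𝒳, ∀ X' ∈ 𝒳, frobNorm (gradl X - gradl X') ≤ Lℓ * frobNorm (X - X'))
    (hgwc : ConvexOn ℝ 𝒳 (fun X => g X + Lg / 2 * frobNorm X ^ 2)) (hρ : 0 ≤ ρ)
    {Y : Matrix (Fin n) (Fin n) ℝ} (hY : frobNorm Y ≤ RY) {Z : Matrix (Fin m) (Fin n) ℝ}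
    {X X' : Matrix (Fin m) (Fin n) ℝ} (hX : X ∈ 𝒳) (hX' : X' ∈ 𝒳)
    (hmin : ∀ W ∈ 𝒳, Ffun ℓ g ρ r ε X Y Z ≤ Ffun ℓ g ρ r ε W Y Z) :
    (r - ((Lℓ + Lg) + 2 * RY + 2 * ρ)) / 2 * frobNorm (X' - X) ^ 2 ≤
      Ffun ℓ g ρ r ε X' Y Z - Ffun ℓ g ρ r ε X Y Z := by
  have hXD : X + (X' - X) ∈ 𝒳 := by rwa [add_sub_cancel]
  set a := (r - ((Lℓ + Lg) + 2 * RY + 2 * ρ)) / 2 * frobNorm (X' - X) ^ 2 with ha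
  have hstep : ∀ t ∈ Set.Ioo (0 : ℝ) 1,
      (1 - t) * a ≤ Ffun ℓ g ρ r ε X' Y Z - Ffun ℓ g ρ r ε X Y Z := by
    intro t ht
    have h := Ffun_add_smul_le h𝒳 r ε hgrad hLip hgwc hρ hY Z hX hXD ht.1.le ht.2.le
    have h2 := hmin _ (h𝒳.add_smul_mem hX hXD ⟨ht.1.le, ht.2.le⟩)
    rw [add_sub_cancel] at h
    refine le_of_mul_le_mul_left ?_ ht.1
    rw [ha]
    linarith
  have hlim : Filter.Tendsto (fun t : ℝ => (1 - t) * a) (nhdsWithin 0 (Set.Ioi 0)) (nhds a) := by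
    have hc : Continuous fun t : ℝ => (1 - t) * a := by fun_prop
    simpa using (hc.tendsto 0).mono_left nhdsWithin_le_nhds
  exact le_of_tendsto hlim (Filter.mem_of_superset (Ioo_mem_nhdsGT zero_lt_one) hstep)

lemma frobInner_Gm_sub_le {m n : ℕ} {RX : ℝ} {X X' : Matrix (Fin m) (Fin n) ℝ}
    (hX : specNorm X ≤ RX) (hX' : specNorm X' ≤ RX) (W : Matrix (Fin n) (Fin n) ℝ) :
    frobInner W (Gm X - Gm X') ≤ 2 * RX * frobNorm W * frobNorm (X - X') := by
  have hsplit : Gm X - Gm X' = Xᵀ * (X - X') + (X'ᵀ * (X - X'))ᵀ := by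
    simp only [Gm, Matrix.transpose_mul, Matrix.transpose_transpose, Matrix.mul_sub,
      Matrix.transpose_sub]
    abel
  have hb : ∀ V : Matrix (Fin m) (Fin n) ℝ, specNorm V ≤ RX → ∀ W : Matrix (Fin n) (Fin n) ℝ,
      frobInner W (Vᵀ * (X - X')) ≤ RX * frobNorm W * frobNorm (X - X') := by
    intro V hV W
    rw [frobInner_mul_right, Matrix.transpose_transpose]
    refine (frobInner_le_frobNorm_mul _ _).trans ?_
    refine mul_le_mul_of_nonneg_right ?_ (frobNorm_nonneg _)
    exact (frobNorm_mul_le V W).trans (mul_le_mul_of_nonneg_right hV (frobNorm_nonneg W))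
  have h1 := hb X hX W
  have h2 := hb X' hX' Wᵀ
  rw [frobNorm_transpose, ← frobInner_transpose, Matrix.transpose_transpose] at h2
  rw [hsplit, frobInner_add_right]
  linarith

/-- Lipschitz continuity of the primal solution map in the dual variable:
`‖X(Y,Z) − X(Y′,Z)‖_F ≤ σ₂‖Y − Y′‖_F`. -/
theorem solution_map_Lipschitz_in_Y {m n : ℕ} (hmn : n ≤ m)
    (𝒳 : Set (Matrix (Fin m) (Fin n) ℝ)) (𝒴 : Set (Matrix (Fin n) (Fin n) ℝ))
    (ℓ g : Matrix (Fin m) (Fin n) ℝ → ℝ)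
    (gradl : Matrix (Fin m) (Fin n) ℝ → Matrix (Fin m) (Fin n) ℝ)
    (Lℓ Lg ρ RX RY r ε μρ σ₂ : ℝ)
    (h𝒳conv : Convex ℝ 𝒳) (h𝒳cpt : IsCompact 𝒳)
    (h𝒳R : ∀ X ∈ 𝒳, specNorm X ≤ RX)
    (hgrad : IsGradientOf gradl ℓ) (hgradcont : Continuous gradl)
    (hgradLip : ∀ X ∈ 𝒳, ∀ X' ∈ 𝒳, frobNorm (gradl X - gradl X') ≤ Lℓ * frobNorm (X - X'))
    (hgwc : ConvexOn ℝ 𝒳 (fun X => g X + Lg / 2 * frobNorm X ^ 2))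
    (h𝒴symm : ∀ Y ∈ 𝒴, Y.IsSymm) (h𝒴conv : Convex ℝ 𝒴) (h𝒴cpt : IsCompact 𝒴)
    (h𝒴zero : (0 : Matrix (Fin n) (Fin n) ℝ) ∈ 𝒴)
    (h𝒴R : ∀ Y ∈ 𝒴, frobNorm Y ≤ RY)
    (hρ : 0 ≤ ρ) (hε : 0 < ε)
    (hμρ : μρ = (Lℓ + Lg) + 2 * RY + 2 * ρ) (hr : μρ < r)
    (hσ₂ : σ₂ = 2 * RX / (r - μρ))
    (Xm : Matrix (Fin n) (Fin n) ℝ → Matrix (Fin m) (Fin n) ℝ → Matrix (Fin m) (Fin n) ℝ)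
    (hXm : ∀ Y Z, Xm Y Z ∈ 𝒳 ∧ ∀ X' ∈ 𝒳, Ffun ℓ g ρ r ε (Xm Y Z) Y Z ≤ Ffun ℓ g ρ r ε X' Y Z) :
    ∀ Y ∈ 𝒴, ∀ Y' ∈ 𝒴, ∀ Z : Matrix (Fin m) (Fin n) ℝ,
      frobNorm (Xm Y Z - Xm Y' Z) ≤ σ₂ * frobNorm (Y - Y') := by
  intro Y hY Y' hY' Z
  obtain ⟨hX, hmin⟩ := hXm Y Z
  obtain ⟨hX', hmin'⟩ := hXm Y' Z
  have h1 := Ffun_quadratic_growth h𝒳conv hgrad hgradLip hgwc hρ (h𝒴R Y hY) hX hX' hmin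
  have h2 := Ffun_quadratic_growth h𝒳conv hgrad hgradLip hgwc hρ (h𝒴R Y' hY') hX' hX hmin'
  generalize Xm Y Z = X at *
  generalize Xm Y' Z = X' at *
  rw [← hμρ] at h1 h2
  have h3 := frobInner_Gm_sub_le (h𝒳R X' hX') (h𝒳R X hX) (Y - Y')
  have hsymm : frobNorm (X' - X) = frobNorm (X - X') := by
    rw [show X' - X = (-1 : ℝ) • (X - X') by module, frobNorm_smul, abs_neg, abs_one, one_mul]
  rw [hsymm] at h1 h3
  simp only [frobInner_sub_left, frobInner_sub_right] at h3
  simp only [Ffun, Lag] at h1 h2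
  have hRX : 0 ≤ RX := (specNorm_nonneg X).trans (h𝒳R X hX)
  have hκ : 0 < r - μρ := sub_pos.2 hr
  have hmul : (r - μρ) * frobNorm (X - X') * frobNorm (X - X') ≤
      2 * RX * frobNorm (Y - Y') * frobNorm (X - X') := by linarith
  rw [hσ₂, div_mul_eq_mul_div, le_div_iff₀ hκ, mul_comm]
  rcases (frobNorm_nonneg (X - X')).eq_or_lt with h0 | h0
  · rw [← h0, mul_zero]
    exact mul_nonneg (mul_nonneg zero_le_two hRX) (frobNorm_nonneg _)
  · exact le_of_mul_le_mul_right hmul h0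

end
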